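/- arXiv:2004.08732 — 5 statements merged into one kernel-verified Lean document; each statement's English description precedes it below -/
import Mathlib

section
/- A 2-edge-coloured graph (G, c_G) admits no improper homomorphism (i.e., every homomorphism of (G, c_G) to any reflexive 2-edge-coloured graph is either trivial or proper) if and only if (G, c_G) is complete convex. -/
/-- In the 2-edge-coloured graph with red edges `R` and blue edges `B`, `v` is
the centre of an alternating 2-path `u, v, w`: edges `uv`, `vw` of different
colours with `u ≠ v` and `v ≠ w`. -/
def AltCentre {V : Type} (R B : SimpleGraph V) (v u w : V) : Prop :=
  u ≠ v ∧ v ≠ w ∧ ((R.Adj u v ∧ B.Adj v w) ∨ (B.Adj u v ∧ R.Adj v w))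

/-- A set `S` of vertices is convex when no vertex outside `S` is the centre of
an alternating 2-path both of whose ends lie in `S`. -/
def TwoECConvex {V : Type} (R B : SimpleGraph V) (S : Set V) : Prop :=
  ∀ v u w, u ∈ S → w ∈ S → AltCentre R B v u w → v ∈ S

/-- The convex hull of `S`: the smallest convex set containing `S`. -/
def twoECConvHull {V : Type} (R B : SimpleGraph V) (S : Set V) : Set V :=
  ⋂₀ {T : Set V | S ⊆ T ∧ TwoECConvex R B T}

/-- A 2-edge-coloured graph is complete convex when the convex hull of (the
ends of) each edge is the whole vertex set. -/
def TwoECCompleteConvex {V : Type} (R B : SimpleGraph V) : Prop :=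
  ∀ u v, (R ⊔ B).Adj u v → twoECConvHull R B {u, v} = Set.univ

theorem subset_twoECConvHull {V : Type} (R B : SimpleGraph V) (S : Set V) :
    S ⊆ twoECConvHull R B S :=
  Set.subset_sInter fun _ hT => hT.1

theorem twoECConvex_twoECConvHull {V : Type} (R B : SimpleGraph V) (S : Set V) :
    TwoECConvex R B (twoECConvHull R B S) :=
  fun v u w hu hw h T hT => hT.2 v u w (hu T hT) (hw T hT) h

/-- Fibres of homomorphisms to reflexive 2-edge-coloured graphs are convex. -/
theorem twoECConvex_fibre {V W : Type} {R B : SimpleGraph V} {R' B' : W → W → Prop}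
    (hR' : Symmetric R') (hB' : Symmetric B')
    (hdisj' : ∀ x y : W, x ≠ y → ¬(R' x y ∧ B' x y)) {φ : V → W}
    (hR : ∀ u v, R.Adj u v → R' (φ u) (φ v)) (hB : ∀ u v, B.Adj u v → B' (φ u) (φ v)) (w : W) :
    TwoECConvex R B {x | φ x = w} := by
  rintro v a b (ha : φ a = w) (hb : φ b = w) ⟨-, -, h⟩
  change φ v = w
  by_contra hne
  rcases h with ⟨h1, h2⟩ | ⟨h1, h2⟩
  · exact hdisj' _ _ hne ⟨hR' (ha ▸ hR _ _ h1), hb ▸ hB _ _ h2⟩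
  · exact hdisj' _ _ hne ⟨hb ▸ hR _ _ h2, hB' (ha ▸ hB _ _ h1)⟩

/-- A vertex outside a convex set is not joined to it by edges of both colours. -/
theorem TwoECConvex.not_adj_adj {V : Type} {R B : SimpleGraph V} {S : Set V}
    (hS : TwoECConvex R B S) {v a b : V} (hv : v ∉ S) (ha : a ∈ S) (hb : b ∈ S) :
    ¬(R.Adj a v ∧ B.Adj b v) := fun ⟨h1, h2⟩ =>
  hv (hS v a b ha hb ⟨h1.ne, h2.ne', Or.inl ⟨h1, h2.symm⟩⟩)

/-- The image of a graph under a map, with a loop added at every vertex. -/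
def reflImage {V W : Type} (G : SimpleGraph V) (φ : V → W) (x y : W) : Prop :=
  x = y ∨ ∃ a b, G.Adj a b ∧ φ a = x ∧ φ b = y

theorem reflImage_symmetric {V W : Type} (G : SimpleGraph V) (φ : V → W) :
    Symmetric (reflImage G φ) := by
  rintro x y (h | ⟨a, b, h, ha, hb⟩)
  · exact Or.inl h.symm
  · exact Or.inr ⟨b, a, h.symm, hb, ha⟩

open Classical in
/-- The map contracting the set `S` to the point `p`. -/
noncomputable def contractTo {V : Type} (S : Set V) (p x : V) : V := if x ∈ S then p else x

theorem contractTo_eq_of_mem {V : Type} {S : Set V} {p x y : V} (hx : x ∈ S) (hy : y ∈ S) :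
    contractTo S p x = contractTo S p y := (if_pos hx).trans (if_pos hy).symm

theorem eq_or_mem_of_contractTo_eq {V : Type} {S : Set V} {p x y : V} (hp : p ∈ S)
    (h : contractTo S p x = contractTo S p y) : x = y ∨ x ∈ S ∧ y ∈ S := by
  unfold contractTo at h
  split_ifs at h with hx hy hy
  · exact Or.inr ⟨hx, hy⟩
  · exact absurd (h ▸ hp) hy
  · exact absurd (h ▸ hp) hx
  · exact Or.inl h

/-- Contracting a convex set does not identify edges of different colours. -/
theorem TwoECConvex.reflImage_contractTo_disjoint {V : Type} {R B : SimpleGraph V}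
    (hdisj : ∀ u v, ¬(R.Adj u v ∧ B.Adj u v)) {S : Set V} (hS : TwoECConvex R B S) {p : V}
    (hp : p ∈ S) {x y : V} (hxy : x ≠ y) :
    ¬(reflImage R (contractTo S p) x y ∧ reflImage B (contractTo S p) x y) := by
  rintro ⟨h | ⟨a, b, h1, rfl, rfl⟩, h | ⟨c, d, h2, hc, hd⟩⟩
  · exact hxy h
  · exact hxy h
  · exact hxy h
  · have hab : ¬(a ∈ S ∧ b ∈ S) := fun ⟨ha, hb⟩ => hxy (contractTo_eq_of_mem ha hb)
    rcases eq_or_mem_of_contractTo_eq hp hc with rfl | ⟨hcS, haS⟩ <;>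
      rcases eq_or_mem_of_contractTo_eq hp hd with rfl | ⟨hdS, hbS⟩
    · exact hdisj _ _ ⟨h1, h2⟩
    · exact hS.not_adj_adj (fun h => hab ⟨h, hbS⟩) hbS hdS ⟨h1.symm, h2.symm⟩
    · exact hS.not_adj_adj (fun h => hab ⟨haS, h⟩) haS hcS ⟨h1, h2⟩
    · exact hab ⟨haS, hbS⟩

/-- a 2-edge-coloured graph admits no improper homomorphism (every
homomorphism to any reflexive 2-edge-coloured graph is trivial or proper) if
and only if it is complete convex. -/
theorem twoec_no_improper_iff_complete_convex
    {V : Type} [Fintype V] (R B : SimpleGraph V)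
    (hdisj : ∀ u v, ¬(R.Adj u v ∧ B.Adj u v)) :
    (∀ (W : Type), Finite W → ∀ R' B' : W → W → Prop,
      Symmetric R' → Symmetric B' → Reflexive R' → Reflexive B' →
      (∀ x y : W, x ≠ y → ¬(R' x y ∧ B' x y)) →
      ∀ φ : V → W, (∀ u v, R.Adj u v → R' (φ u) (φ v)) →
        (∀ u v, B.Adj u v → B' (φ u) (φ v)) →
        (∃ w, ∀ x, φ x = w) ∨ (∀ u v, (R ⊔ B).Adj u v → φ u ≠ φ v))
    ↔ TwoECCompleteConvex R B := by
  constructor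
  · intro h u v huv
    have hu : u ∈ twoECConvHull R B {u, v} := subset_twoECConvHull R B _ (Set.mem_insert _ _)
    have hv : v ∈ twoECConvHull R B {u, v} :=
      subset_twoECConvHull R B _ (Set.mem_insert_of_mem _ rfl)
    have hS := twoECConvex_twoECConvHull R B {u, v}
    generalize twoECConvHull R B {u, v} = S at *
    have hφu : contractTo S u u = u := if_pos hu
    have hφv : contractTo S u v = u := if_pos hv
    rcases h V inferInstance _ _ (reflImage_symmetric R (contractTo S u))
      (reflImage_symmetric B (contractTo S u)) (fun _ => Or.inl rfl) (fun _ => Or.inl rfl)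
      (fun _ _ hxy => hS.reflImage_contractTo_disjoint hdisj hu hxy) (contractTo S u)
      (fun a b hab => Or.inr ⟨a, b, hab, rfl, rfl⟩)
      (fun a b hab => Or.inr ⟨a, b, hab, rfl, rfl⟩) with ⟨w, hw⟩ | hproper
    · refine Set.eq_univ_of_forall fun x => by_contra fun hx => hx ?_
      have hφx : contractTo S u x = x := if_neg hx
      rwa [← hφx, hw x, ← hw u, hφu]
    · exact absurd (hφu.trans hφv.symm) (hproper u v huv)
  · intro h W _ R' B' hR' hB' _ _ hdisj' φ hR hB
    refine or_iff_not_imp_right.2 fun hproper => ?_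
    push Not at hproper
    obtain ⟨u, v, huv, he⟩ := hproper
    refine ⟨φ u, fun x => ?_⟩
    have hx : x ∈ twoECConvHull R B {u, v} := h u v huv ▸ Set.mem_univ x
    exact hx {x | φ x = φ u} ⟨by rintro y (rfl | rfl); exacts [rfl, he.symm],
      twoECConvex_fibre hR' hB' hdisj' hR hB (φ u)⟩
end

section
/- Let T be a connected graph of tree-width at most 2 with at least two vertices (equivalently, a connected spanning subgraph of a 2-tree). An orientation T⃗ of T admits no improper homomorphism (every homomorphism of T⃗ to any reflexive oriented graph is trivial or proper) if and only if T is itself a 2-tree and every induced copy of K3 in T is oriented as a directed 3-cycle in T⃗. -/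
/-- The graph obtained from `G` by adding a new vertex adjacent to exactly the
two endpoints `x`, `y` of an existing edge. -/
def addApexVertex {V : Type} (G : SimpleGraph V) (x y : V) : SimpleGraph (Option V) :=
  SimpleGraph.fromRel (fun a b =>
    (∃ va vb, a = some va ∧ b = some vb ∧ G.Adj va vb) ∨
    (a = none ∧ (b = some x ∨ b = some y)))

/-- 2-trees: graphs obtained from `K2` by repeatedly adding a new vertex
adjacent to exactly the two endpoints of an existing edge (up to isomorphism). -/
inductive Is2Tree : {V : Type} → SimpleGraph V → Prop
  | base : Is2Tree (⊤ : SimpleGraph (Fin 2))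
  | extend {V : Type} (G : SimpleGraph V) (x y : V) (hxy : G.Adj x y) :
      Is2Tree G → Is2Tree (addApexVertex G x y)
  | iso {V W : Type} (G : SimpleGraph V) (H : SimpleGraph W) :
      Is2Tree G → G ≃g H → Is2Tree H

/-- `A` has no improper homomorphism to a finite reflexive oriented graph. -/
def NoImproperHom {V : Type} (A : V → V → Prop) : Prop :=
  ∀ (W : Type), Finite W → ∀ B : W → W → Prop,
    Reflexive B → (∀ x y : W, x ≠ y → B x y → ¬ B y x) →
    ∀ φ : V → W, (∀ u v, A u v → B (φ u) (φ v)) →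
      (∃ w, ∀ x, φ x = w) ∨ (∀ u v, A u v → φ u ≠ φ v)

/-- The triple `x`, `y`, `z` is a directed 3-cycle of `A`, in one of the two directions. -/
def IsDirectedTriangle {V : Type} (A : V → V → Prop) (x y z : V) : Prop :=
  (A x y ∧ A y z ∧ A z x) ∨ (A y x ∧ A x z ∧ A z y)

section addApexVertex

variable {V : Type} {G : SimpleGraph V} {x y : V}

@[simp]
lemma addApexVertex_adj_some_some {a b : V} :
    (addApexVertex G x y).Adj (some a) (some b) ↔ G.Adj a b := by
  simp only [addApexVertex, SimpleGraph.fromRel_adj]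
  constructor
  · rintro ⟨-, (⟨_, _, h1, h2, h⟩ | h) | (⟨_, _, h1, h2, h⟩ | h)⟩
    · cases h1; cases h2; exact h
    · simp at h
    · cases h1; cases h2; exact h.symm
    · simp at h
  · intro h
    exact ⟨by simpa using h.ne, .inl (.inl ⟨_, _, rfl, rfl, h⟩)⟩

@[simp]
lemma addApexVertex_adj_none_some {b : V} :
    (addApexVertex G x y).Adj none (some b) ↔ b = x ∨ b = y := by
  simp [addApexVertex, SimpleGraph.fromRel_adj]

end addApexVertex

namespace Is2Tree

lemma finite {V : Type} {G : SimpleGraph V} (h : Is2Tree G) : Finite V := by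
  induction h with
  | base => infer_instance
  | extend G x y hxy _ ih => infer_instance
  | iso G H _ e ih => exact Finite.of_equiv _ e.toEquiv

/-- A vertex colouring of a 2-tree that is constant on every triangle with two equally coloured
vertices, and constant on some edge, is constant. -/
lemma eq_of_edge_eq {V : Type} {G : SimpleGraph V} (h : Is2Tree G) {W : Type} (φ : V → W)
    (htri : ∀ a b c, G.Adj a b → G.Adj b c → G.Adj a c → φ a = φ b → φ c = φ a)
    {u v : V} (huv : G.Adj u v) (hφ : φ u = φ v) : ∃ w, ∀ a, φ a = w := by
  induction h with
  | base =>
    refine ⟨φ u, fun a => ?_⟩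
    have : a = u ∨ a = v := by
      have := huv.ne
      omega
    rcases this with rfl | rfl <;> simp [hφ]
  | extend G x y hxy _ ih =>
    have hxy' : (addApexVertex G x y).Adj (some x) (some y) := by simpa using hxy
    have hnx : (addApexVertex G x y).Adj none (some x) := by simp
    have hny : (addApexVertex G x y).Adj none (some y) := by simp
    have key : ∀ a b, G.Adj a b → φ (some a) = φ (some b) → ∃ w, ∀ a, φ a = w := by
      intro a b hab h
      obtain ⟨w, hw⟩ := ih (fun a => φ (some a))
        (fun a b c h1 h2 h3 => htri _ _ _ (by simpa using h1) (by simpa using h2)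
          (by simpa using h3)) hab h
      refine ⟨w, fun a => ?_⟩
      cases a with
      | some a => exact hw a
      | none =>
        rw [htri _ _ _ hxy' hny.symm hnx.symm ((hw x).trans (hw y).symm)]
        exact hw x
    have key' : ∀ b, (b = x ∨ b = y) → φ none = φ (some b) → ∃ w, ∀ a, φ a = w := by
      rintro b (rfl | rfl) h
      · exact key _ _ hxy (h.symm.trans (htri _ _ _ hnx hxy' hny h).symm)
      · exact key _ _ hxy ((htri _ _ _ hny hxy'.symm hnx h).trans h)
    rcases u with _ | u <;> rcases v with _ | v
    · exact (huv.ne rfl).elim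
    · exact key' v (by simpa using huv) hφ
    · exact key' u (by simpa using huv.symm) hφ.symm
    · exact key u v (by simpa using huv) hφ
  | iso G H _ e ih =>
    obtain ⟨w, hw⟩ := ih (φ ∘ e)
      (fun a b c h1 h2 h3 => htri _ _ _ (e.map_adj_iff.2 h1) (e.map_adj_iff.2 h2)
        (e.map_adj_iff.2 h3)) (u := e.symm u) (v := e.symm v)
      (e.symm.map_adj_iff.2 huv) (by simpa using hφ)
    exact ⟨w, fun a => by simpa using hw (e.symm a)⟩

end Is2Tree

/-- If all neighbours of `v` lie in `{p, q}` and contracting the edge `vp` does not give an improper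
homomorphism, then `q` is the middle vertex of a directed path between `v` and `p`. -/
lemma NoImproperHom.exists_directed_path {V : Type} [Finite V] {A : V → V → Prop}
    (hA : NoImproperHom A) (hanti : ∀ u v, A u v → ¬ A v u) {v p q : V}
    (hpv : p ≠ v) (hqv : q ≠ v) (hpq : p ≠ q) (hadj : A v p ∨ A p v)
    (hout : ∀ u, A v u → u = p ∨ u = q) (hin : ∀ u, A u v → u = p ∨ u = q) :
    (A v q ∧ A q p) ∨ (A p q ∧ A q v) := by
  classical
  by_contra hpath
  let φ : V → V := fun u => if u = v then p else u
  have hφv : φ v = p := if_pos rfl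
  have hφ : ∀ u, u ≠ v → φ u = u := fun u hu => if_neg hu
  let B : V → V → Prop := fun a b => a = b ∨ ∃ u w, A u w ∧ φ u = a ∧ φ w = b
  have hB : ∀ a b, a ≠ b → B a b → A a b ∨ (a = p ∧ b = q ∧ A v q) ∨ (a = q ∧ b = p ∧ A q v) := by
    rintro a b hab (h | ⟨u, w, huw, rfl, rfl⟩)
    · exact (hab h).elim
    · by_cases hu : u = v
      · subst hu
        rcases hout w huw with rfl | rfl
        · exact (hab (hφv.trans (hφ _ hpv).symm)).elim
        · exact .inr (.inl ⟨hφv, hφ _ hqv, huw⟩)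
      · by_cases hw : w = v
        · subst hw
          rcases hin u huw with rfl | rfl
          · exact (hab ((hφ _ hpv).trans hφv.symm)).elim
          · exact .inr (.inr ⟨hφ _ hqv, hφv, huw⟩)
        · exact .inl (by rwa [hφ u hu, hφ w hw])
  have hBanti : ∀ a b, a ≠ b → B a b → ¬ B b a := by
    intro a b hab hab' hba'
    rcases hB a b hab hab' with h1 | ⟨rfl, rfl, h1⟩ | ⟨rfl, rfl, h1⟩ <;>
      rcases hB _ _ hab.symm hba' with h2 | ⟨h3, h4, h2⟩ | ⟨h3, h4, h2⟩
    · exact hanti _ _ h1 h2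
    · subst h3 h4
      exact hpath (.inl ⟨h2, h1⟩)
    · subst h3 h4
      exact hpath (.inr ⟨h1, h2⟩)
    · exact hpath (.inl ⟨h1, h2⟩)
    · exact hab h4
    · exact hanti _ _ h1 h2
    · exact hpath (.inr ⟨h2, h1⟩)
    · exact hanti _ _ h2 h1
    · exact hab h4
  rcases hA V inferInstance B (fun a => .inl rfl) hBanti φ
    (fun u w huw => .inr ⟨u, w, huw, rfl, rfl⟩) with ⟨w, hw⟩ | h
  · exact hpq ((hφ p hpv).symm.trans ((hw p).trans ((hw q).symm.trans (hφ q hqv))))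
  · rcases hadj with h' | h'
    · exact h _ _ h' (hφv.trans (hφ p hpv).symm)
    · exact h _ _ h' ((hφ p hpv).trans hφv.symm)

/-- In an orientation without improper homomorphisms, a vertex `v` whose neighbours lie in `{p, q}`
and which is adjacent to `p` forms a directed triangle with `p` and `q`. -/
lemma NoImproperHom.isDirectedTriangle {V : Type} [Finite V] {A : V → V → Prop}
    (hA : NoImproperHom A) (hanti : ∀ u v, A u v → ¬ A v u) {v p q : V}
    (hpv : p ≠ v) (hqv : q ≠ v) (hpq : p ≠ q) (hadj : A v p ∨ A p v)
    (hout : ∀ u, A v u → u = p ∨ u = q) (hin : ∀ u, A u v → u = p ∨ u = q) :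
    IsDirectedTriangle A v p q := by
  have h1 := hA.exists_directed_path hanti hpv hqv hpq hadj hout hin
  have h2 := hA.exists_directed_path hanti hqv hpv hpq.symm (h1.imp And.left And.right)
    (fun u hu => (hout u hu).symm) (fun u hu => (hin u hu).symm)
  rcases h1 with ⟨hvq, hqp⟩ | ⟨hpq', hqv'⟩ <;> rcases h2 with ⟨hvp, hpq'⟩ | ⟨hqp', hpv'⟩
  · exact (hanti _ _ hqp hpq').elim
  · exact .inr ⟨hpv', hvq, hqp⟩
  · exact .inl ⟨hvp, hpq', hqv'⟩
  · exact (hanti _ _ hpq' hqp').elim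

/-- Deleting a vertex whose neighbours are exactly two vertices forming an edge keeps a graph
connected. -/
lemma connected_comap_some {V : Type} {T : SimpleGraph (Option V)} (hT : T.Connected) {x y : V}
    (hxy : T.Adj (some x) (some y)) (hn : ∀ b, T.Adj none (some b) → b = x ∨ b = y) :
    (T.comap some).Connected := by
  have hx : ∀ b, T.Adj none (some b) → (T.comap some).Reachable x b := by
    intro b hb
    rcases hn b hb with rfl | rfl
    · exact .refl _
    · exact SimpleGraph.Adj.reachable (by simpa using hxy)
  have key : ∀ a b, T.Reachable a b →
      (T.comap some).Reachable (a.getD x) (b.getD x) := by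
    rintro a b ⟨w⟩
    induction w with
    | nil => exact .refl _
    | @cons a c _ h _ ih =>
      refine SimpleGraph.Reachable.trans ?_ ih
      rcases a with _ | a <;> rcases c with _ | c
      · exact .refl _
      · exact hx c h
      · exact (hx a h.symm).symm
      · exact SimpleGraph.Adj.reachable (by simpa using h)
  have : Nonempty V := ⟨x⟩
  exact ⟨fun a b => key (some a) (some b) (hT.preconnected _ _)⟩

/-- Deleting a vertex whose neighbours lie in `{x, y}` preserves the absence of improper
homomorphisms. -/
lemma NoImproperHom.comap_some {V : Type} {A : Option V → Option V → Prop}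
    (hA : NoImproperHom A) (hanti : ∀ u v, A u v → ¬ A v u) {x y : V}
    (hout : ∀ u, A none (some u) → u = x ∨ u = y) (hin : ∀ u, A (some u) none → u = x ∨ u = y) :
    NoImproperHom (fun a b => A (some a) (some b)) := by
  intro W _ B hrefl hB φ hφ
  by_cases hxy : φ x = φ y
  · refine (hA W ‹_› B hrefl hB (fun a => a.elim (φ x) φ) ?_).imp
      (fun ⟨w, hw⟩ => ⟨w, fun a => hw (some a)⟩) (fun h u v => h (some u) (some v))
    rintro (_ | u) (_ | v) h
    · exact hrefl _
    · rcases hout v h with rfl | rfl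
      · exact hrefl _
      · simpa [hxy] using hrefl _
    · rcases hin u h with rfl | rfl
      · exact hrefl _
      · simpa [hxy] using hrefl _
    · exact hφ _ _ h
  · let B' : Option W → Option W → Prop
      | none, none => True
      | none, some w => ∃ u, A none (some u) ∧ φ u = w
      | some w, none => ∃ u, A (some u) none ∧ φ u = w
      | some w, some z => B w z
    have hdigon : ∀ u v, A none (some u) → A (some v) none → φ u ≠ φ v := by
      intro u v hu hv h
      rcases hout u hu with rfl | rfl <;> rcases hin v hv with rfl | rfl
      · exact hanti _ _ hu hv
      · exact hxy h
      · exact hxy h.symm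
      · exact hanti _ _ hu hv
    refine (hA (Option W) inferInstance B' ?_ ?_ (Option.map φ) ?_).imp ?_ ?_
    · rintro (_ | w)
      · trivial
      · exact hrefl w
    · rintro (_ | w) (_ | z) hne h1 h2
      · exact hne rfl
      · obtain ⟨u, hu, rfl⟩ := h1
        obtain ⟨v, hv, h⟩ := h2
        exact hdigon u v hu hv h.symm
      · obtain ⟨u, hu, rfl⟩ := h2
        obtain ⟨v, hv, h⟩ := h1
        exact hdigon u v hu hv h.symm
      · exact hB w z (by simpa using hne) h1 h2
    · rintro (_ | u) (_ | v) h
      · trivial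
      · exact ⟨v, h, rfl⟩
      · exact ⟨u, h, rfl⟩
      · exact hφ _ _ h
    · rintro ⟨w, hw⟩
      exact ⟨φ x, fun a => by simpa using (hw (some a)).trans (hw (some x)).symm⟩
    · intro h u v huv he
      exact h _ _ huv (congrArg some he)

/-- An orientation without improper homomorphisms of a connected spanning subgraph of a 2-tree is an
orientation of a 2-tree in which all triangles are directed. -/
lemma Is2Tree.of_noImproperHom {V : Type} {T' : SimpleGraph V} (h : Is2Tree T')
    {T : SimpleGraph V} (hle : T ≤ T') (hconn : T.Connected) {A : V → V → Prop}
    (horient : ∀ u v, A u v ∨ A v u ↔ T.Adj u v) (hanti : ∀ u v, A u v → ¬ A v u)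
    (hA : NoImproperHom A) :
    Is2Tree T ∧ ∀ x y z : V, T.Adj x y → T.Adj y z → T.Adj x z → IsDirectedTriangle A x y z := by
  induction h with
  | base =>
    refine ⟨?_, fun x y z h1 h2 h3 => ?_⟩
    · have h01 : T.Adj 0 1 := by
        obtain ⟨b, hb⟩ := hconn.preconnected.exists_adj_of_nontrivial 0
        have hb1 : b = 1 := by
          have := hb.ne
          omega
        exact hb1 ▸ hb
      have : T = ⊤ := by
        ext a b
        fin_cases a <;> fin_cases b <;> simp [h01, h01.symm]
      exact this ▸ .base
    · have := h1.ne
      have := h2.ne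
      have := h3.ne
      omega
  | extend G x y hxy hG ih =>
    have : Finite _ := hG.finite
    have hn : ∀ b, T.Adj none (some b) → b = x ∨ b = y := fun b hb => by simpa using hle hb
    have hout : ∀ u, A none u → u = some x ∨ u = some y := by
      rintro (_ | u) h
      · exact (((horient _ _).1 (.inl h)).ne rfl).elim
      · simpa using hn u ((horient _ _).1 (.inl h))
    have hin : ∀ u, A u none → u = some x ∨ u = some y := by
      rintro (_ | u) h
      · exact (((horient _ _).1 (.inl h)).ne rfl).elim
      · simpa using hn u ((horient _ _).1 (.inr h))
    have hxy' : some x ≠ some y := by simpa using hxy.ne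
    have : Nontrivial (Option _) := ⟨⟨_, _, hxy'⟩⟩
    have hcyc : IsDirectedTriangle A none (some x) (some y) := by
      obtain ⟨b, hb⟩ := hconn.preconnected.exists_adj_of_nontrivial none
      rcases b with _ | b
      · exact (hb.ne rfl).elim
      · rcases hn b hb with rfl | rfl
        · exact hA.isDirectedTriangle hanti (by simp) (by simp) hxy' ((horient _ _).2 hb) hout hin
        · have := hA.isDirectedTriangle hanti (by simp) (by simp) hxy'.symm ((horient _ _).2 hb)
            (fun u hu => (hout u hu).symm) (fun u hu => (hin u hu).symm)
          simp only [IsDirectedTriangle] at this ⊢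
          tauto
    have hTxy : T.Adj (some x) (some y) := by
      rw [← horient]
      simp only [IsDirectedTriangle] at hcyc
      tauto
    have hTx : T.Adj none (some x) := by
      rw [← horient]
      simp only [IsDirectedTriangle] at hcyc
      tauto
    have hTy : T.Adj none (some y) := by
      rw [← horient]
      simp only [IsDirectedTriangle] at hcyc
      tauto
    obtain ⟨h2, htri⟩ := ih (T := T.comap some) (fun a b hab => by simpa using hle hab)
      (connected_comap_some hconn hTxy hn) (A := fun a b => A (some a) (some b))
      (fun u v => horient _ _) (fun u v => hanti _ _)
      (hA.comap_some hanti (fun u hu => by simpa using hout _ hu)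
        (fun u hu => by simpa using hin _ hu))
    have hT : addApexVertex (T.comap some) x y = T := by
      have hnone : ∀ b, (b = x ∨ b = y) ↔ T.Adj none (some b) :=
        fun b => ⟨by rintro (rfl | rfl) <;> assumption, hn b⟩
      ext a b
      rcases a with _ | a <;> rcases b with _ | b
      · simp
      · simp [hnone]
      · rw [SimpleGraph.adj_comm, T.adj_comm]
        simp [hnone]
      · simp
    refine ⟨hT ▸ .extend _ x y (by simpa using hTxy) h2, ?_⟩
    have hapex : ∀ b c, T.Adj none (some b) → T.Adj (some b) (some c) → T.Adj none (some c) →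
        IsDirectedTriangle A none (some b) (some c) := by
      intro b c hb hbc hc
      rcases hn b hb with rfl | rfl <;> rcases hn c hc with rfl | rfl
      · exact (hbc.ne rfl).elim
      · exact hcyc
      · simp only [IsDirectedTriangle] at hcyc ⊢
        tauto
      · exact (hbc.ne rfl).elim
    rintro (_ | a) (_ | b) (_ | c) h1 h2 h3
    · exact (h1.ne rfl).elim
    · exact (h1.ne rfl).elim
    · exact (h3.ne rfl).elim
    · exact hapex b c h1 h2 h3
    · exact (h2.ne rfl).elim
    · have := hapex a c h1.symm h3 h2
      simp only [IsDirectedTriangle] at this ⊢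
      tauto
    · have := hapex a b h3.symm h1 h2.symm
      simp only [IsDirectedTriangle] at this ⊢
      tauto
    · exact htri a b c h1 h2 h3
  | iso G H _ e ih =>
    have f : T.comap e ≃g T := SimpleGraph.Iso.comap e.toEquiv T
    obtain ⟨h2, htri⟩ := ih (T := T.comap e)
      (fun a b hab => e.map_adj_iff.1 (hle hab)) (f.connected_iff.2 hconn)
      (A := fun a b => A (e a) (e b)) (fun u v => horient _ _) (fun u v => hanti _ _) (by
        intro W hW B hrefl hB φ hφ
        refine (hA W hW B hrefl hB (φ ∘ e.symm)
          (fun u v huv => hφ _ _ (by simpa using huv))).imp ?_ ?_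
        · rintro ⟨w, hw⟩
          exact ⟨w, fun a => by simpa using hw (e a)⟩
        · intro h u v huv
          simpa using h _ _ huv)
    refine ⟨.iso _ _ h2 f, fun x y z h1 h2 h3 => ?_⟩
    simpa [IsDirectedTriangle] using
      htri (e.symm x) (e.symm y) (e.symm z) (by simpa using h1) (by simpa using h2)
        (by simpa using h3)

/-- for a connected graph `T` of tree-width at most 2 with at
least two vertices (a connected spanning subgraph of a 2-tree), an orientation
`A` of `T` admits no improper homomorphism (every homomorphism to any reflexive
oriented graph is trivial or proper) if and only if `T` is itself a 2-tree and
every induced copy of `K3` in `T` is oriented as a directed 3-cycle. -/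
theorem treewidth_two_no_improper_iff
    {V : Type} [Fintype V] (T : SimpleGraph V)
    (hconn : T.Connected) (hcard : 2 ≤ Fintype.card V)
    (htw : ∃ T' : SimpleGraph V, T ≤ T' ∧ Is2Tree T')
    (A : V → V → Prop)
    (horient : ∀ u v, A u v ∨ A v u ↔ T.Adj u v)
    (hanti : ∀ u v, A u v → ¬ A v u) :
    (∀ (W : Type), Finite W → ∀ B : W → W → Prop,
      Reflexive B → (∀ x y : W, x ≠ y → B x y → ¬ B y x) →
      ∀ φ : V → W, (∀ u v, A u v → B (φ u) (φ v)) →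
        (∃ w, ∀ x, φ x = w) ∨ (∀ u v, A u v → φ u ≠ φ v))
    ↔ (Is2Tree T ∧ ∀ x y z : V, T.Adj x y → T.Adj y z → T.Adj x z →
        ((A x y ∧ A y z ∧ A z x) ∨ (A y x ∧ A x z ∧ A z y))) := by
  constructor
  · intro hA
    obtain ⟨T', hle, hT'⟩ := htw
    exact hT'.of_noImproperHom hle hconn horient hanti hA
  · rintro ⟨hT, htri⟩ W _ B hrefl hB φ hφ
    by_contra! hcon
    obtain ⟨hne, u, v, huv, he⟩ := hcon
    have hcol : ∀ a b c, T.Adj a b → T.Adj b c → T.Adj a c → φ a = φ b → φ c = φ a := by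
      intro a b c h1 h2 h3 hab
      by_contra hca
      rcases htri a b c h1 h2 h3 with ⟨-, hbc, hca'⟩ | ⟨-, hac, hcb⟩
      · exact hB _ _ hca (hφ _ _ hca') (hab ▸ hφ _ _ hbc)
      · exact hB _ _ hca (hab ▸ hφ _ _ hcb) (hφ _ _ hac)
    obtain ⟨w, hw⟩ := hT.eq_of_edge_eq φ hcol ((horient u v).1 (.inl huv)) he
    obtain ⟨x, hx⟩ := hne w
    exact hx (hw x)
end

section
/- Let G⃗ be an oriented graph and let a be an arc of G⃗. Let G⃗_a denote the oriented graph obtained from G⃗ by reversing the orientation of a, and let G⃗ − a denote the oriented graph obtained from G⃗ by deleting a. If both G⃗ and G⃗_a are complete convex, then G⃗ − a is complete convex. -/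
/-- `v` is the centre of a 2-dipath `u, v, w` in the oriented graph with arc
relation `A`: arcs `uv`, `vw` with `u ≠ v` and `v ≠ w`. -/
def TwoDipathCentre {V : Type} (A : V → V → Prop) (v u w : V) : Prop :=
  u ≠ v ∧ v ≠ w ∧ A u v ∧ A v w

/-- A set `S` of vertices is convex when no vertex outside `S` is the centre of
a 2-dipath both of whose ends lie in `S`. -/
def OrientConvex {V : Type} (A : V → V → Prop) (S : Set V) : Prop :=
  ∀ v u w, u ∈ S → w ∈ S → TwoDipathCentre A v u w → v ∈ S

/-- The convex hull of `S`: the smallest convex set containing `S`. -/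
def orientConvHull {V : Type} (A : V → V → Prop) (S : Set V) : Set V :=
  ⋂₀ {T : Set V | S ⊆ T ∧ OrientConvex A T}

/-- An oriented graph is complete convex when the convex hull of (the ends of)
each arc is the whole vertex set. -/
def OrientCompleteConvex {V : Type} (A : V → V → Prop) : Prop :=
  ∀ u v, A u v → orientConvHull A {u, v} = Set.univ

theorem orientCompleteConvex_iff {V : Type} (A : V → V → Prop) :
    OrientCompleteConvex A ↔
      ∀ u v, A u v → ∀ T : Set V, u ∈ T → v ∈ T → OrientConvex A T → ∀ x, x ∈ T := by
  constructor
  · intro h u v huv T hu hv hT x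
    have hx : x ∈ orientConvHull A {u, v} := h u v huv ▸ Set.mem_univ x
    exact hx T ⟨Set.insert_subset hu (Set.singleton_subset_iff.2 hv), hT⟩
  · intro h u v huv
    refine Set.eq_univ_of_forall fun x T hT => ?_
    exact h u v huv T (hT.1 (by simp)) (hT.1 (by simp)) hT.2 x

/-- if an oriented graph `A` with arc `pq` and the oriented graph
obtained by reversing that arc are both complete convex, then the oriented
graph obtained by deleting the arc is complete convex. -/
theorem delete_reversible_arc_complete_convex
    {V : Type} [Fintype V] (A : V → V → Prop)
    (hirr : Irreflexive A) (hanti : ∀ u v, A u v → ¬ A v u)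
    (p q : V) (hpq : A p q)
    (hG : OrientCompleteConvex A)
    (hGa : OrientCompleteConvex
      (fun u v => (A u v ∧ ¬(u = p ∧ v = q)) ∨ (u = q ∧ v = p))) :
    OrientCompleteConvex (fun u v => A u v ∧ ¬(u = p ∧ v = q)) := by
  rw [orientCompleteConvex_iff] at hG hGa ⊢
  rintro u v ⟨huv, hne⟩ T hu hv hT x
  by_contra hx
  have hA : ¬ OrientConvex A T := fun h => hx (hG u v huv T hu hv h x)
  have hA' := fun h => hx (hGa u v (Or.inl ⟨huv, hne⟩) T hu hv h x)
  have hpq' : p ≠ q := by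
    rintro rfl
    exact hanti _ _ hpq hpq
  unfold OrientConvex TwoDipathCentre at hA hA' hT
  push Not at hA
  obtain ⟨c, y, z, hy, hz, ⟨hyc, hcz, hAyc, hAcz⟩, hc⟩ := hA
  apply hA'
  rintro c' y' z' hy' hz' ⟨hyc', hcz', hAyc', hAcz'⟩
  by_contra hc'
  have h₁ := hT c y z hy hz
  have h₂ := hT c' y' z' hy' hz'
  have h₃ := hT c y z' hy hz'
  have h₄ := hT c y' z hy' hz
  have h₅ := hanti y c
  have h₆ := hanti c z
  clear hT hA' hG hGa hanti hirr
  grind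
end

section
/- Let (G, c_G) be a complete-convex 2-edge-coloured graph whose underlying graph G is not isomorphic to K2. Then every vertex of G has degree at least 3. -/
theorem TwoECCompleteConvex.mem_of_convex {V : Type} {R B : SimpleGraph V}
    (hcc : TwoECCompleteConvex R B) {S : Set V} (hS : TwoECConvex R B S) {u v : V}
    (huv : (R ⊔ B).Adj u v) (hu : u ∈ S) (hv : v ∈ S) (x : V) : x ∈ S := by
  have hx : x ∈ twoECConvHull R B {u, v} := by simp [hcc u v huv]
  exact hx S ⟨by simp [Set.insert_subset_iff, hu, hv], hS⟩

theorem twoECConvex_compl_singleton {V : Type} {R B : SimpleGraph V} {v : V}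
    (hv : ¬ ∃ a b, R.Adj v a ∧ B.Adj v b) : TwoECConvex R B {v}ᶜ := by
  rintro x u w - - ⟨-, -, h⟩ rfl
  rcases h with ⟨h₁, h₂⟩ | ⟨h₁, h₂⟩
  exacts [hv ⟨u, w, h₁.symm, h₂⟩, hv ⟨w, u, h₂, h₁.symm⟩]

theorem TwoECCompleteConvex.exists_red_blue_adj {V : Type} [Fintype V] {R B : SimpleGraph V}
    (hdisj : ∀ u v, ¬(R.Adj u v ∧ B.Adj u v))
    (hconn : (R ⊔ B).Connected) (hcard : 2 ≤ Fintype.card V)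
    (hK2 : ¬ Nonempty ((R ⊔ B) ≃g (⊤ : SimpleGraph (Fin 2))))
    (hcc : TwoECCompleteConvex R B) (v : V) : ∃ a b, R.Adj v a ∧ B.Adj v b := by
  by_contra hv
  have : Nontrivial V := Fintype.one_lt_card_iff_nontrivial.mp hcard
  obtain ⟨u, hvu⟩ := hconn.preconnected.exists_adj_of_nontrivial v
  have hu_only : ∀ w, (R ⊔ B).Adj u w → w = v := fun w huw ↦ by
    by_contra hwv
    exact hcc.mem_of_convex (twoECConvex_compl_singleton hv) huw hvu.ne' hwv v rfl
  have hu : ¬ ∃ a b, R.Adj u a ∧ B.Adj u b := by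
    rintro ⟨a, b, ha, hb⟩
    obtain rfl := hu_only a (Or.inl ha)
    obtain rfl := hu_only b (Or.inr hb)
    exact hdisj _ _ ⟨ha, hb⟩
  have hv_only : ∀ w, (R ⊔ B).Adj v w → w = u := fun w hvw ↦ by
    by_contra hwu
    exact hcc.mem_of_convex (twoECConvex_compl_singleton hu) hvw hvu.ne hwu u rfl
  have hconvex : TwoECConvex R B {u, v} := by
    rintro x y w (rfl | rfl) - ⟨-, -, h⟩
    · exact Or.inr (hu_only x (h.imp And.left And.left))
    · exact Or.inl (hv_only x (h.imp And.left And.left))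
  have hall : ∀ x, x = u ∨ x = v := hcc.mem_of_convex hconvex hvu (Or.inr rfl) (Or.inl rfl)
  have htop : R ⊔ B = ⊤ := by
    ext x y
    refine ⟨fun h ↦ h.ne, fun hxy ↦ ?_⟩
    rcases hall x with rfl | rfl <;> rcases hall y with rfl | rfl
    exacts [(hxy rfl).elim, hvu.symm, hvu, (hxy rfl).elim]
  have hcard_two : Fintype.card V = 2 := by
    classical
    refine le_antisymm ?_ hcard
    have huniv : (Finset.univ : Finset V) = {u, v} := by ext x; simpa using hall x
    rw [← Finset.card_univ, huniv]
    exact Finset.card_le_two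
  exact hK2 ⟨htop ▸ SimpleGraph.Iso.completeGraph (Fintype.equivFinOfCardEq hcard_two)⟩

/-- a complete-convex 2-edge-coloured graph whose (connected)
underlying graph is not isomorphic to `K2` has minimum degree at least 3:
every vertex has three pairwise distinct neighbours. -/
theorem complete_convex_min_degree_three
    {V : Type} [Fintype V] (R B : SimpleGraph V)
    (hdisj : ∀ u v, ¬(R.Adj u v ∧ B.Adj u v))
    (hconn : (R ⊔ B).Connected) (hcard : 2 ≤ Fintype.card V)
    (hK2 : ¬ Nonempty ((R ⊔ B) ≃g (⊤ : SimpleGraph (Fin 2))))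
    (hcc : TwoECCompleteConvex R B) :
    ∀ v : V, ∃ x y z : V, x ≠ y ∧ x ≠ z ∧ y ≠ z ∧
      (R ⊔ B).Adj v x ∧ (R ⊔ B).Adj v y ∧ (R ⊔ B).Adj v z := by
  intro v
  by_contra hdeg
  obtain ⟨a, b, ha, hb⟩ := hcc.exists_red_blue_adj hdisj hconn hcard hK2 v
  have hab : a ≠ b := by
    rintro rfl
    exact hdisj _ _ ⟨ha, hb⟩
  have hv_only : ∀ x, (R ⊔ B).Adj v x → x = a ∨ x = b := fun x hx ↦ by
    by_contra! h
    exact hdeg ⟨a, b, x, hab, h.1.symm, h.2.symm, Or.inl ha, Or.inr hb, hx⟩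
  have hR : R.Adj a b := by
    by_contra hR
    have hconvex : TwoECConvex R B {v, a} := by
      intro x u w hu hw h
      simp only [AltCentre, Set.mem_insert_iff, Set.mem_singleton_iff, SimpleGraph.sup_adj] at *
      grind [SimpleGraph.adj_comm]
    rcases hcc.mem_of_convex hconvex (Or.inl ha) (by simp) (by simp) b with h | h
    exacts [hb.ne' h, hab h.symm]
  have hB : B.Adj a b := by
    by_contra hB
    have hconvex : TwoECConvex R B {v, b} := by
      intro x u w hu hw h
      simp only [AltCentre, Set.mem_insert_iff, Set.mem_singleton_iff, SimpleGraph.sup_adj] at *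
      grind [SimpleGraph.adj_comm]
    rcases hcc.mem_of_convex hconvex (Or.inr hb) (by simp) (by simp) a with h | h
    exacts [ha.ne' h, hab h]
  exact hdisj _ _ ⟨hR, hB⟩
end

section
/- Let F be a nonempty family of irreflexive connected graphs, each with at least two vertices, that is closed with respect to edge contraction (whenever G ∈ F and e is an edge of G, the simple graph obtained from G by contracting e lies in F). Let F⃗ denote the set of all orientations of members of F, and let F⃗_c denote the set of complete-convex orientations of members of F. If χ_s(F⃗) is finite, then χ_s(F⃗) = χ(F⃗_c): the least k such that every member of F⃗ admits a non-trivial homomorphism to some reflexive tournament on k vertices equals the least k such that every member of F⃗_c admits a homomorphism to some tournament on k vertices. -/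
/-- A tournament on `k` vertices: an irreflexive oriented graph in which every
pair of distinct vertices is joined by exactly one arc. -/
def IsTournament {k : ℕ} (B : Fin k → Fin k → Prop) : Prop :=
  Irreflexive B ∧ ∀ i j, i ≠ j → (B i j ↔ ¬ B j i)

/-- A reflexive tournament on `k` vertices: a loop at every vertex and exactly
one arc between any two distinct vertices. -/
def IsReflTournament {k : ℕ} (B : Fin k → Fin k → Prop) : Prop :=
  Reflexive B ∧ ∀ i j, i ≠ j → (B i j ↔ ¬ B j i)

/-- `A` is an orientation of the graph `G`: each edge of `G` receives exactly
one of its two possible directions. -/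
def IsOrientationOf {V : Type} (A : V → V → Prop) (G : SimpleGraph V) : Prop :=
  (∀ u v, A u v ∨ A v u ↔ G.Adj u v) ∧ ∀ u v, A u v → ¬ A v u

/-- The graph obtained from `G` by contracting the edge `xy`: `x` and `y` are
identified (the merged vertex being `x`), loops are deleted and parallel edges
merged. -/
def contractEdge {V : Type} (G : SimpleGraph V) (x y : V) :
    SimpleGraph {v : V // v ≠ y} :=
  SimpleGraph.fromRel (fun a b =>
    G.Adj a.1 b.1 ∨ (a.1 = x ∧ G.Adj y b.1) ∨ (b.1 = x ∧ G.Adj a.1 y))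

open Relation

theorem contractEdge_adj {V : Type} {G : SimpleGraph V} {x y : V} {a b : {v : V // v ≠ y}} :
    (contractEdge G x y).Adj a b ↔
      a ≠ b ∧ (G.Adj a.1 b.1 ∨ (a.1 = x ∧ G.Adj y b.1) ∨ (b.1 = x ∧ G.Adj a.1 y)) := by
  simp only [contractEdge, SimpleGraph.fromRel_adj]
  grind [G.adj_comm]

/-- A map that identifies the ends of the edge `xy` induces the same image graph from `G` and from
the contraction of `xy`. -/
theorem contractEdge_map {V W : Type} {G : SimpleGraph V} {f : V → W} {x y : V}
    (hf : f x = f y) (hxy : G.Adj x y) :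
    (contractEdge G x y).map (fun v => f v.1) = G.map f := by
  ext a b
  simp only [SimpleGraph.map_adj', contractEdge_adj]
  refine and_congr_right fun hab => ⟨?_, ?_⟩
  · rintro ⟨u, v, ⟨-, h | ⟨hu, h⟩ | ⟨hv, h⟩⟩, rfl, rfl⟩
    · exact ⟨u, v, h, rfl, rfl⟩
    · exact ⟨y, v, h, by rw [hu, hf], rfl⟩
    · exact ⟨u, y, h, rfl, by rw [hv, hf]⟩
  · rintro ⟨u, v, h, rfl, rfl⟩
    by_cases hu : u = y
    · subst hu
      have hv : v ≠ u := h.ne'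
      exact ⟨⟨x, hxy.ne⟩, ⟨v, hv⟩, ⟨by grind, Or.inr (Or.inl ⟨rfl, h⟩)⟩, hf, rfl⟩
    · by_cases hv : v = y
      · subst hv
        exact ⟨⟨u, hu⟩, ⟨x, hxy.ne⟩, ⟨by grind, Or.inr (Or.inr ⟨rfl, h⟩)⟩, rfl, hf⟩
      · exact ⟨⟨u, hu⟩, ⟨v, hv⟩, ⟨by grind, Or.inl h⟩, rfl, rfl⟩

/-- Each fibre of `f` induces a preconnected subgraph of `G`. -/
def FibresPreconnected {V W : Type} (G : SimpleGraph V) (f : V → W) : Prop :=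
  ∀ u v, f u = f v → ReflTransGen (fun a b => G.Adj a b ∧ f a = f b) u v

theorem FibresPreconnected.contractEdge {V W : Type} {G : SimpleGraph V} {f : V → W}
    (h : FibresPreconnected G f) {x y : V} (hf : f x = f y) (hxy : G.Adj x y) :
    FibresPreconnected (contractEdge G x y) (fun v => f v.1) := by
  classical
  intro u v huv
  let c : V → {v : V // v ≠ y} := fun v => if hv : v = y then ⟨x, hxy.ne⟩ else ⟨v, hv⟩
  have hc : ∀ v : {v : V // v ≠ y}, c v.1 = v := fun v => dif_neg v.2
  rw [← hc u, ← hc v]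
  refine ReflTransGen.lift' c (fun a b hab => ?_) _ _ (h _ _ huv)
  change ReflTransGen _ (c a) (c b)
  by_cases hcab : c a = c b
  · rw [hcab]
  · refine ReflTransGen.single ⟨contractEdge_adj.2 ⟨hcab, ?_⟩, ?_⟩
    · have := hab.1
      grind
    · have := hab.2
      grind

theorem FibresPreconnected.comp_iso_symm {V V' W : Type} {G : SimpleGraph V} {G' : SimpleGraph V'}
    {f : V → W} (h : FibresPreconnected G f) (e : G ≃g G') :
    FibresPreconnected G' (fun v => f (e.symm v)) := by
  intro u v huv
  rw [← e.apply_symm_apply u, ← e.apply_symm_apply v]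
  refine ReflTransGen.lift' e (fun a b hab => ReflTransGen.single ?_) _ _ (h _ _ huv)
  exact ⟨e.map_adj_iff.2 hab.1, by simpa using hab.2⟩

theorem SimpleGraph.map_comp_iso_symm {V V' W : Type} {G : SimpleGraph V} {G' : SimpleGraph V'}
    (f : V → W) (e : G ≃g G') : G'.map (fun v => f (e.symm v)) = G.map f := by
  ext a b
  simp only [SimpleGraph.map_adj']
  refine and_congr_right fun _ => ⟨?_, ?_⟩
  · rintro ⟨u, v, h, rfl, rfl⟩
    exact ⟨e.symm u, e.symm v, e.symm.map_adj_iff.2 h, rfl, rfl⟩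
  · rintro ⟨u, v, h, rfl, rfl⟩
    exact ⟨e u, e v, e.map_adj_iff.2 h, by simp, by simp⟩

/-- A family closed under edge contraction is closed under contracting the parts of any partition
into at least two connected sets. -/
theorem exists_iso_map_of_contraction_closed {F : Set ((V : Type) × SimpleGraph V)}
    (hfin : ∀ p ∈ F, Finite p.1)
    (hcontract : ∀ p ∈ F, ∀ x y : p.1, p.2.Adj x y →
      2 ≤ Nat.card {v : p.1 // v ≠ y} →
      ∃ q ∈ F, Nonempty (contractEdge p.2 x y ≃g q.2))
    {W : Type} (hW : 2 ≤ Nat.card W) {p : (V : Type) × SimpleGraph V} (hp : p ∈ F)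
    {f : p.1 → W} (hsurj : Function.Surjective f) (hf : FibresPreconnected p.2 f) :
    ∃ q ∈ F, Nonempty (p.2.map f ≃g q.2) := by
  induction hn : Nat.card p.1 using Nat.strong_induction_on generalizing p with
  | _ n ih =>
    have := hfin p hp
    by_cases hedge : ∃ x y, p.2.Adj x y ∧ f x = f y
    · obtain ⟨x, y, hxy, hfxy⟩ := hedge
      have hsurj' : Function.Surjective (fun v : {v : p.1 // v ≠ y} => f v.1) := by
        intro w
        obtain ⟨v, rfl⟩ := hsurj w
        by_cases hv : v = y
        · exact ⟨⟨x, hxy.ne⟩, by rw [hv]; exact hfxy⟩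
        · exact ⟨⟨v, hv⟩, rfl⟩
      obtain ⟨q, hq, ⟨e⟩⟩ := hcontract p hp x y hxy
        (hW.trans (Nat.card_le_card_of_surjective _ hsurj'))
      have hlt : Nat.card q.1 < n := by
        rw [← Nat.card_congr e.toEquiv, ← hn]
        exact Finite.card_subtype_lt (x := y) (by simp)
      have hmap : q.2.map (fun v => f (e.symm v).1) = p.2.map f :=
        (SimpleGraph.map_comp_iso_symm (fun v : {v : p.1 // v ≠ y} => f v.1) e).trans
          (contractEdge_map hfxy hxy)
      rw [← hmap]
      exact ih _ hlt hq (hsurj'.comp e.symm.surjective)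
        ((hf.contractEdge hfxy hxy).comp_iso_symm e) rfl
    · have hinj : Function.Injective f := by
        intro u v huv
        rcases (hf u v huv).cases_head with h | ⟨c, hc, -⟩
        · exact h
        · exact absurd ⟨u, c, hc⟩ hedge
      exact ⟨p, hp, ⟨(SimpleGraph.Iso.map (Equiv.ofBijective f ⟨hinj, hsurj⟩) p.2).symm⟩⟩

theorem subset_orientConvHull {V : Type} (A : V → V → Prop) (S : Set V) :
    S ⊆ orientConvHull A S :=
  fun _ hv _ hT => hT.1 hv

theorem orientConvHull_subset {V : Type} {A : V → V → Prop} {S T : Set V} (hST : S ⊆ T)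
    (hT : OrientConvex A T) : orientConvHull A S ⊆ T :=
  fun _ hv => hv T ⟨hST, hT⟩

theorem orientConvex_orientConvHull {V : Type} (A : V → V → Prop) (S : Set V) :
    OrientConvex A (orientConvHull A S) :=
  fun v u w hu hw hc T hT => hT.2 v u w (hu T hT) (hw T hT) hc

/-- The convex hull of an arc is connected. -/
theorem reflTransGen_of_mem_orientConvHull {V : Type} {A : V → V → Prop} {u v : V} (huv : A u v)
    {w : V} (hw : w ∈ orientConvHull A {u, v}) :
    ReflTransGen (fun a b => (A a b ∨ A b a) ∧
      a ∈ orientConvHull A {u, v} ∧ b ∈ orientConvHull A {u, v}) u w := by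
  set S := orientConvHull A {u, v} with hS
  have hu : u ∈ S := subset_orientConvHull A _ (by simp)
  have hv : v ∈ S := subset_orientConvHull A _ (by simp)
  refine (orientConvHull_subset (T := {w | w ∈ S ∧ ReflTransGen (fun a b => (A a b ∨ A b a) ∧
      a ∈ S ∧ b ∈ S) u w}) ?_ ?_ hw).2
  · rintro w (rfl | rfl)
    · exact ⟨hu, .refl⟩
    · exact ⟨hv, .single ⟨Or.inl huv, hu, hv⟩⟩
  · rintro z x y ⟨hx, hxr⟩ ⟨hy, -⟩ hz
    have hzS : z ∈ S := orientConvex_orientConvHull A _ z x y hx hy hz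
    exact ⟨hzS, hxr.tail ⟨Or.inl hz.2.2.1, hx, hzS⟩⟩

theorem orientConvex_fibre {V : Type} {A : V → V → Prop} {k : ℕ} {B : Fin k → Fin k → Prop}
    (hB : IsReflTournament B) {φ : V → Fin k} (hφ : ∀ u v, A u v → B (φ u) (φ v)) (b : Fin k) :
    OrientConvex A (φ ⁻¹' {b}) := by
  rintro v u w rfl hw ⟨-, -, huv, hvw⟩
  by_contra hne
  have h := hφ _ _ hvw
  rw [show φ w = φ u from hw] at h
  exact (hB.2 _ _ hne).1 h (hφ _ _ huv)

/-- A non-trivial homomorphism from a complete-convex oriented graph to a reflexive tournament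
never uses a loop. -/
theorem OrientCompleteConvex.exists_tournament {V : Type} {A : V → V → Prop}
    (hA : OrientCompleteConvex A) {k : ℕ} {B : Fin k → Fin k → Prop} (hB : IsReflTournament B)
    {φ : V → Fin k} (hφ : ∀ u v, A u v → B (φ u) (φ v)) (hnt : ¬∃ w, ∀ x, φ x = w) :
    ∃ B' : Fin k → Fin k → Prop, IsTournament B' ∧
      ∃ φ : V → Fin k, ∀ u v, A u v → B' (φ u) (φ v) := by
  refine ⟨fun i j => i ≠ j ∧ B i j, ⟨fun i h => h.1 rfl, fun i j hij => ?_⟩, φ,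
    fun u v huv => ⟨fun h => hnt ⟨φ v, fun x => ?_⟩, hφ u v huv⟩⟩
  · have := hB.2 i j hij
    have := hij.symm
    tauto
  · refine orientConvHull_subset (S := {u, v}) ?_ (orientConvex_fibre hB hφ (φ v))
      (hA u v huv ▸ Set.mem_univ x)
    rintro w (rfl | rfl)
    · exact h
    · rfl

/-- Contracting a convex set to a single vertex leaves an oriented graph. -/
theorem OrientConvex.isOrientationOf_map {V : Type} {G : SimpleGraph V} {A : V → V → Prop}
    (hA : IsOrientationOf A G) {S : Set V} (hS : OrientConvex A S) {W : Type} {f : V → W}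
    (hf : ∀ a b, f a = f b → a = b ∨ (a ∈ S ∧ b ∈ S)) (hfS : ∀ a ∈ S, ∀ b ∈ S, f a = f b) :
    IsOrientationOf (fun a b => a ≠ b ∧ ∃ u v, A u v ∧ f u = a ∧ f v = b) (G.map f) := by
  refine ⟨fun a b => ?_, ?_⟩
  · rw [SimpleGraph.map_adj']
    constructor
    · rintro (⟨hab, u, v, h, hu, hv⟩ | ⟨hab, u, v, h, hu, hv⟩)
      · exact ⟨hab, u, v, (hA.1 u v).1 (Or.inl h), hu, hv⟩
      · exact ⟨hab.symm, v, u, (hA.1 v u).1 (Or.inr h), hv, hu⟩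
    · rintro ⟨hab, u, v, h, hu, hv⟩
      rcases (hA.1 u v).2 h with h | h
      · exact Or.inl ⟨hab, u, v, h, hu, hv⟩
      · exact Or.inr ⟨hab.symm, v, u, h, hv, hu⟩
  · rintro _ _ ⟨hab, u, v, huv, rfl, rfl⟩ ⟨-, v', u', hvu, hv, hu⟩
    have huv' : u ≠ v := fun h => hab (h ▸ rfl)
    have hvu' : v' ≠ u' := fun h => hab (by rw [← hu, ← hv, h])
    rcases hf _ _ hu with rfl | ⟨hu'S, huS⟩ <;> rcases hf _ _ hv with rfl | ⟨hv'S, hvS⟩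
    · exact hA.2 _ _ huv hvu
    · exact hab (hfS _ (hS u' v' v hv'S hvS ⟨hvu', huv', hvu, huv⟩) _ hvS)
    · exact hab (hfS _ huS _ (hS v' u u' huS hu'S ⟨huv', hvu', huv, hvu⟩))
    · exact hab (hfS _ huS _ hvS)

/-- A non-trivial homomorphism to a reflexive tournament exists on every orientation of a member
of a contraction-closed family as soon as the complete-convex ones map to tournaments of the same
order. -/
theorem exists_nontrivial_hom_of_contraction_closed {F : Set ((V : Type) × SimpleGraph V)}
    (hfin : ∀ p ∈ F, Finite p.1) (hconn : ∀ p ∈ F, p.2.Connected)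
    (hcard : ∀ p ∈ F, 2 ≤ Nat.card p.1)
    (hcontract : ∀ p ∈ F, ∀ x y : p.1, p.2.Adj x y →
      2 ≤ Nat.card {v : p.1 // v ≠ y} →
      ∃ q ∈ F, Nonempty (contractEdge p.2 x y ≃g q.2))
    {k : ℕ} (hk : ∀ p ∈ F, ∀ A : p.1 → p.1 → Prop, IsOrientationOf A p.2 →
      OrientCompleteConvex A →
      ∃ B : Fin k → Fin k → Prop, IsTournament B ∧
        ∃ φ : p.1 → Fin k, ∀ u v, A u v → B (φ u) (φ v))
    {p : (V : Type) × SimpleGraph V} (hp : p ∈ F) {A : p.1 → p.1 → Prop}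
    (hA : IsOrientationOf A p.2) :
    ∃ B : Fin k → Fin k → Prop, IsReflTournament B ∧
      ∃ φ : p.1 → Fin k, (∀ u v, A u v → B (φ u) (φ v)) ∧ ¬∃ w, ∀ x, φ x = w := by
  classical
  induction hn : Nat.card p.1 using Nat.strong_induction_on generalizing p with
  | _ n ih =>
    have := hfin p hp
    by_cases hc : OrientCompleteConvex A
    · obtain ⟨B, hB, φ, hφ⟩ := hk p hp A hA hc
      refine ⟨fun i j => i = j ∨ B i j, ⟨fun i => Or.inl rfl, fun i j hij => ?_⟩, φ,
        fun u v h => Or.inr (hφ u v h), ?_⟩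
      · have := hB.2 i j hij
        have := hij.symm
        tauto
      · rintro ⟨w, hw⟩
        have : Nontrivial p.1 := Finite.one_lt_card_iff_nontrivial.1 (hcard p hp)
        have hirr : ∀ u v, ¬A u v := fun u v huv => hB.1 w (by simpa [hw] using hφ u v huv)
        obtain ⟨x⟩ := (hconn p hp).nonempty
        obtain ⟨y, hxy⟩ := (hconn p hp).preconnected.exists_adj_of_nontrivial x
        rcases (hA.1 x y).2 hxy with h | h
        · exact hirr _ _ h
        · exact hirr _ _ h
    · simp only [OrientCompleteConvex, not_forall, Set.ne_univ_iff_exists_notMem] at hc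
      obtain ⟨u, v, huv, z, hz⟩ := hc
      have hconv := orientConvex_orientConvHull A {u, v}
      have hgen := fun w => reflTransGen_of_mem_orientConvHull huv (w := w)
      have hu : u ∈ orientConvHull A {u, v} := subset_orientConvHull A _ (by simp)
      have hv : v ∈ orientConvHull A {u, v} := subset_orientConvHull A _ (by simp)
      generalize orientConvHull A {u, v} = S at *
      have hvu : v ≠ u := by
        rintro rfl
        exact hA.2 _ _ huv huv
      let W := {w : p.1 // w ∈ S → w = u}
      let f : p.1 → W := fun w => if hw : w ∈ S then ⟨u, fun _ => rfl⟩ else ⟨w, fun h => absurd h hw⟩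
      have hfS : ∀ a ∈ S, ∀ b ∈ S, f a = f b := by
        intro a ha b hb
        simp [f, ha, hb]
      have hf : ∀ a b, f a = f b → a = b ∨ (a ∈ S ∧ b ∈ S) := by
        intro a b hab
        grind
      have hsurj : Function.Surjective f := by
        rintro ⟨w, hw⟩
        refine ⟨w, ?_⟩
        grind
      have hsym : Std.Symm (fun a b => p.2.Adj a b ∧ f a = f b) :=
        ⟨fun a b h => ⟨h.1.symm, h.2.symm⟩⟩
      have hbase : ∀ w ∈ S, ReflTransGen (fun a b => p.2.Adj a b ∧ f a = f b) u w :=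
        fun w hw => ReflTransGen.mono
          (fun a b h => ⟨(hA.1 a b).1 h.1, hfS a h.2.1 b h.2.2⟩) _ _ (hgen w hw)
      have hpre : FibresPreconnected p.2 f := by
        intro a b hab
        rcases hf a b hab with rfl | ⟨ha, hb⟩
        · exact .refl
        · exact (symm (hbase a ha)).trans (hbase b hb)
      have hW : 2 ≤ Nat.card W := by
        have : Nontrivial W := ⟨f u, f z, fun h => by grind⟩
        exact Finite.one_lt_card
      obtain ⟨q, hq, ⟨e⟩⟩ := exists_iso_map_of_contraction_closed hfin hcontract hW hp hsurj hpre
      have hlt : Nat.card q.1 < n := by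
        rw [← Nat.card_congr e.toEquiv, ← hn]
        exact Finite.card_subtype_lt (x := v) (by simp [hv, hvu])
      have hA' := hconv.isOrientationOf_map hA hf hfS
      obtain ⟨B, hB, φ, hφ, hnt⟩ := ih _ hlt hq
        (A := fun a b => e.symm a ≠ e.symm b ∧ ∃ u v, A u v ∧ f u = e.symm a ∧ f v = e.symm b)
        ⟨fun a b => (hA'.1 _ _).trans e.symm.map_adj_iff, fun a b => hA'.2 _ _⟩ rfl
      refine ⟨B, hB, fun w => φ (e (f w)), fun a b hab => ?_, ?_⟩
      · by_cases h : f a = f b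
        · simpa only [h] using hB.1 _
        · exact hφ _ _ (by simpa using ⟨h, a, b, hab, rfl, rfl⟩)
      · rintro ⟨w, hw⟩
        refine hnt ⟨w, fun x => ?_⟩
        obtain ⟨y, hy⟩ := hsurj (e.symm x)
        simpa [hy] using hw y

/-- let `F` be a nonempty family of finite irreflexive connected
graphs, each with at least two vertices, closed with respect to edge
contraction (whenever the contraction again has at least two vertices, some
member of `F` is isomorphic to it).  If the simple chromatic number of the
family of all orientations of members of `F` is finite, then it equals the
chromatic number of the family of complete-convex orientations of members of
`F`. -/
theorem contraction_closed_simple_chrom_eq_chrom_of_complete_convex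
    (F : Set ((V : Type) × SimpleGraph V))
    (hne : F.Nonempty)
    (hfin : ∀ p ∈ F, Finite p.1)
    (hconn : ∀ p ∈ F, p.2.Connected)
    (hcard : ∀ p ∈ F, 2 ≤ Nat.card p.1)
    (hcontract : ∀ p ∈ F, ∀ x y : p.1, p.2.Adj x y →
      2 ≤ Nat.card {v : p.1 // v ≠ y} →
      ∃ q ∈ F, Nonempty (contractEdge p.2 x y ≃g q.2))
    (hfinite : {k : ℕ | ∀ p ∈ F, ∀ A : p.1 → p.1 → Prop, IsOrientationOf A p.2 →
      ∃ B : Fin k → Fin k → Prop, IsReflTournament B ∧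
        ∃ φ : p.1 → Fin k, (∀ u v, A u v → B (φ u) (φ v)) ∧
          ¬∃ w, ∀ x, φ x = w}.Nonempty) :
    sInf {k : ℕ | ∀ p ∈ F, ∀ A : p.1 → p.1 → Prop, IsOrientationOf A p.2 →
      ∃ B : Fin k → Fin k → Prop, IsReflTournament B ∧
        ∃ φ : p.1 → Fin k, (∀ u v, A u v → B (φ u) (φ v)) ∧
          ¬∃ w, ∀ x, φ x = w}
    = sInf {k : ℕ | ∀ p ∈ F, ∀ A : p.1 → p.1 → Prop, IsOrientationOf A p.2 →
        OrientCompleteConvex A →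
        ∃ B : Fin k → Fin k → Prop, IsTournament B ∧
          ∃ φ : p.1 → Fin k, ∀ u v, A u v → B (φ u) (φ v)} := by
  congr 1
  ext k
  refine ⟨fun hk p hp A hA hc => ?_, fun hk p hp A hA => ?_⟩
  · obtain ⟨B, hB, φ, hφ, hnt⟩ := hk p hp A hA
    exact hc.exists_tournament hB hφ hnt
  · exact exists_nontrivial_hom_of_contraction_closed hfin hconn hcard hcontract hk hp hA
end
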